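/- Let p be an odd prime and d ≥ 2. There exist g : Z_p^d → ℂ with ‖g‖₂ = 1 and sets A, B ⊆ Z_p^d such that G(g, A, B) is an orthonormal basis of L²(Z_p^d), and moreover: (1) |g| is not a constant multiple of the indicator function of any set, and (2) |ĝ| is not a constant multiple of the indicator function of any set. -/

import Mathlib

open Finset

/-- The fixed character `χ(t) = e^{2πi t/p}` of `ℤ/p`. -/
noncomputable def chi (p : ℕ) (t : ZMod p) : ℂ :=
  Complex.exp (2 * Real.pi * Complex.I * (t.val : ℂ) / (p : ℂ))

/-- The dot product on `ℤ_p^d`. -/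
def dotp {p d : ℕ} (x y : Fin d → ZMod p) : ZMod p := ∑ i, x i * y i

/-- The Gabor (time-frequency shifted) function `x ↦ g(x-a) χ(x·b)`. -/
noncomputable def gabor {p d : ℕ} (g : (Fin d → ZMod p) → ℂ) (a b : Fin d → ZMod p) :
    (Fin d → ZMod p) → ℂ :=
  fun x => g (x - a) * chi p (dotp x b)

/-- The inner product of `L²` with counting measure on a finite type. -/
noncomputable def innerC {V : Type*} [Fintype V] (f g : V → ℂ) : ℂ :=
  ∑ x, f x * (starRingEnd ℂ) (g x)

/-- `𝒢(g, A, B)` is an orthonormal basis of `L²(ℤ_p^d)`: the family is orthonormal and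
every function is a linear combination of its members. -/
def IsGaborONB {p d : ℕ} [NeZero p] (g : (Fin d → ZMod p) → ℂ)
    (A B : Finset (Fin d → ZMod p)) : Prop :=
  (∀ a ∈ A, ∀ b ∈ B, ∀ a' ∈ A, ∀ b' ∈ B,
    innerC (gabor g a b) (gabor g a' b') = if a = a' ∧ b = b' then 1 else 0)
  ∧ (∀ f : (Fin d → ZMod p) → ℂ, ∃ c : (Fin d → ZMod p) → (Fin d → ZMod p) → ℂ,
      f = fun x => ∑ a ∈ A, ∑ b ∈ B, c a b * gabor g a b x)

/-- `(E, B)` is a spectral pair: the characters indexed by `B` are pairwise orthogonal in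
`L²(E)` and span it. -/
def IsSpectralPair {p d : ℕ} [NeZero p] (E B : Finset (Fin d → ZMod p)) : Prop :=
  (∀ b ∈ B, ∀ b' ∈ B, b ≠ b' → ∑ x ∈ E, chi p (dotp x (b - b')) = 0)
  ∧ (∀ f : (Fin d → ZMod p) → ℂ, ∃ c : (Fin d → ZMod p) → ℂ,
      ∀ x ∈ E, f x = ∑ b ∈ B, c b * chi p (dotp x b))

/-- `(E, A)` is a tiling pair: `Σ_{a∈A} 1_E(x-a) = 1` for every `x`. -/
def IsTilingPair {p d : ℕ} [NeZero p] (E A : Finset (Fin d → ZMod p)) : Prop :=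
  ∀ x : Fin d → ZMod p, (∑ a ∈ A, if x - a ∈ E then (1 : ℕ) else 0) = 1

/-- The Fourier transform `ĝ(m) = p^{-d} Σ_x χ(-x·m) g(x)` on `ℤ_p^d`. -/
noncomputable def ft {p d : ℕ} [NeZero p] (g : (Fin d → ZMod p) → ℂ)
    (m : Fin d → ZMod p) : ℂ :=
  ((p : ℂ) ^ d)⁻¹ * ∑ x, chi p (-(dotp x m)) * g x

theorem chi_eq_stdAddChar (p : ℕ) [NeZero p] (t : ZMod p) : chi p t = ZMod.stdAddChar t := by
  rw [ZMod.stdAddChar_apply, ZMod.toCircle_apply, chi]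

theorem dotp_cons {p n : ℕ} (u v : ZMod p) (y z : Fin n → ZMod p) :
    dotp (Fin.cons u y : Fin (n + 1) → ZMod p) (Fin.cons v z) = u * v + dotp y z := by
  simp [dotp, Fin.sum_univ_succ]

theorem sum_stdAddChar_mul (p : ℕ) [NeZero p] (b : ZMod p) :
    ∑ x : ZMod p, ZMod.stdAddChar (x * b) = if b = 0 then (p : ℂ) else 0 := by
  have h := AddChar.sum_mulShift b (ZMod.isPrimitive_stdAddChar p)
  simpa [ZMod.card] using h

/-- Orthogonality of the characters of `ℤ_p^n`. -/
theorem sum_stdAddChar_dotp (p : ℕ) [NeZero p] {n : ℕ} (b : Fin n → ZMod p) :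
    ∑ y : Fin n → ZMod p, ZMod.stdAddChar (dotp y b) = if b = 0 then (p : ℂ) ^ n else 0 := by
  have h : ∀ y : Fin n → ZMod p, ZMod.stdAddChar (dotp y b) =
      ∏ i, (ZMod.stdAddChar (y i * b i) : ℂ) := fun y => by
    exact map_prod (ZMod.stdAddChar (N := p)).toMonoidHom
      (fun i => Multiplicative.ofAdd (y i * b i)) Finset.univ
  simp_rw [h]
  rw [← Fintype.prod_sum (fun i (t : ZMod p) => (ZMod.stdAddChar (t * b i) : ℂ))]
  simp_rw [sum_stdAddChar_mul]
  split_ifs with hb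
  · simp [hb]
  · obtain ⟨i, hi⟩ := Function.ne_iff.mp hb
    exact Finset.prod_eq_zero (Finset.mem_univ i) (if_neg hi)

theorem conj_stdAddChar (p : ℕ) [NeZero p] (t : ZMod p) :
    (starRingEnd ℂ) (ZMod.stdAddChar t) = ZMod.stdAddChar (-t) := by
  rw [AddChar.map_neg_eq_conj]

theorem sum_fin_cons {p n : ℕ} [NeZero p] (F : (Fin (n + 1) → ZMod p) → ℂ) :
    ∑ x, F x = ∑ y : Fin n → ZMod p, ∑ u : ZMod p, F (Fin.cons u y) := by
  rw [← (Fin.consEquiv fun _ => ZMod p).sum_comp, Fintype.sum_prod_type_right]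
  rfl

/-- The inverse partial Fourier transform, in the first coordinate, of `1 - 2 · 1_{0}`,
rescaled by the real factor `C`. -/
noncomputable def gaborWindow (p n : ℕ) (C : ℝ) (x : Fin (n + 1) → ZMod p) : ℂ :=
  C * ((if x 0 = 0 then (p : ℂ) else 0) - if Fin.tail x = 0 then 2 else 0)

theorem gaborWindow_cons (p n : ℕ) (C : ℝ) (u : ZMod p) (y : Fin n → ZMod p) :
    gaborWindow p n C (Fin.cons u y) =
      C * ((if u = 0 then (p : ℂ) else 0) - if y = 0 then 2 else 0) := by
  simp [gaborWindow]

theorem gabor_gaborWindow_cons (p n : ℕ) [NeZero p] (C : ℝ) (s u : ZMod p)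
    (b y : Fin n → ZMod p) :
    gabor (gaborWindow p n C) (Fin.cons s 0) (Fin.cons 0 b) (Fin.cons u y) =
      gaborWindow p n C (Fin.cons (u - s) y) * ZMod.stdAddChar (dotp y b) := by
  have h : (Fin.cons u y - Fin.cons s 0 : Fin (n + 1) → ZMod p) = Fin.cons (u - s) y := by
    ext i
    refine Fin.cases ?_ (fun j => ?_) i <;> simp
  simp [gabor, h, dotp_cons, chi_eq_stdAddChar]

/-- On every fibre of the first coordinate, distinct translates of the window are orthogonal and
all have the same norm. -/
theorem sum_gaborWindow_mul (p n : ℕ) [NeZero p] (C : ℝ) (s t : ZMod p) (y : Fin n → ZMod p) :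
    ∑ u, gaborWindow p n C (Fin.cons (u - s) y) * gaborWindow p n C (Fin.cons (u - t) y) =
      if s = t then (C : ℂ) ^ 2 * p ^ 2 else 0 := by
  have key : ∀ e : ℂ, e = 0 ∨ e = 2 →
      ∑ u : ZMod p, (C * ((if u - s = 0 then (p : ℂ) else 0) - e)) *
        (C * ((if u - t = 0 then (p : ℂ) else 0) - e)) =
      if s = t then (C : ℂ) ^ 2 * p ^ 2 else 0 := by
    intro e he
    have expand : ∀ u : ZMod p, (C * ((if u - s = 0 then (p : ℂ) else 0) - e)) *
        (C * ((if u - t = 0 then (p : ℂ) else 0) - e)) =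
        (C : ℂ) ^ 2 * ((if u = s then (if s = t then (p : ℂ) ^ 2 else 0) else 0)
          - (if u = s then (p : ℂ) * e else 0) - (if u = t then (p : ℂ) * e else 0) + e ^ 2) := by
      intro u
      simp only [sub_eq_zero]
      by_cases h1 : u = s
      · subst h1
        by_cases h2 : u = t <;> simp [h2] <;> ring
      · simp only [h1, if_false]
        split_ifs <;> ring
    simp_rw [expand]
    rw [← Finset.mul_sum, Finset.sum_add_distrib, Finset.sum_sub_distrib, Finset.sum_sub_distrib]
    simp only [Finset.sum_ite_eq', Finset.mem_univ, if_true, Finset.sum_const, Finset.card_univ,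
      ZMod.card, nsmul_eq_mul]
    rcases he with rfl | rfl <;> split_ifs <;> ring
  simp_rw [gaborWindow_cons]
  exact key _ (by split_ifs <;> simp)

theorem conj_gaborWindow (p n : ℕ) (C : ℝ) (x : Fin (n + 1) → ZMod p) :
    (starRingEnd ℂ) (gaborWindow p n C x) = gaborWindow p n C x := by
  unfold gaborWindow
  split_ifs <;> simp [Complex.conj_ofNat]

theorem innerC_gabor_gaborWindow (p n : ℕ) [NeZero p] (C : ℝ) (hC : C ^ 2 * (p : ℝ) ^ (n + 2) = 1)
    (s t : ZMod p) (b c : Fin n → ZMod p) :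
    innerC (gabor (gaborWindow p n C) (Fin.cons s 0) (Fin.cons 0 b))
      (gabor (gaborWindow p n C) (Fin.cons t 0) (Fin.cons 0 c)) =
      if s = t ∧ b = c then 1 else 0 := by
  have hC' : (C : ℂ) ^ 2 * (p : ℂ) ^ (n + 2) = 1 := by exact_mod_cast hC
  have hdot : ∀ y : Fin n → ZMod p, dotp y b + -dotp y c = dotp y (b - c) := fun y => by
    simp [dotp, mul_sub, Finset.sum_sub_distrib, ← sub_eq_add_neg]
  have hfib : ∀ y : Fin n → ZMod p, ∑ u,
      gabor (gaborWindow p n C) (Fin.cons s 0) (Fin.cons 0 b) (Fin.cons u y) *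
      (starRingEnd ℂ) (gabor (gaborWindow p n C) (Fin.cons t 0) (Fin.cons 0 c) (Fin.cons u y)) =
      (if s = t then (C : ℂ) ^ 2 * p ^ 2 else 0) * ZMod.stdAddChar (dotp y (b - c)) := by
    intro y
    rw [← sum_gaborWindow_mul p n C s t y, Finset.sum_mul]
    refine Finset.sum_congr rfl fun u _ => ?_
    rw [gabor_gaborWindow_cons, gabor_gaborWindow_cons, map_mul, conj_gaborWindow, conj_stdAddChar,
      ← hdot, AddChar.map_add_eq_mul]
    ring
  rw [innerC, sum_fin_cons]
  simp_rw [hfib]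
  rw [← Finset.mul_sum, sum_stdAddChar_dotp]
  by_cases hs : s = t <;> by_cases hb : b = c <;> simp [hs, hb, sub_eq_zero]
  rw [← hC']
  ring

/-- An orthonormal family indexed by the points of a finite type spans all functions on it. -/
theorem exists_eq_sum_of_innerC_eq_ite {ι V : Type*} [Fintype ι] [Fintype V] [DecidableEq ι]
    [DecidableEq V] (e : ι ≃ V) (φ : ι → V → ℂ)
    (h : ∀ i j, innerC (φ i) (φ j) = if i = j then 1 else 0) (f : V → ℂ) :
    ∃ c : ι → ℂ, ∀ x, f x = ∑ i, c i * φ i x := by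
  let M : Matrix ι ι ℂ := Matrix.of fun i j => φ i (e j)
  have hM : M * M.conjTranspose = 1 := by
    ext i j
    rw [Matrix.mul_apply, Matrix.one_apply, ← h i j, innerC, ← e.sum_comp]
    rfl
  have hM' := mul_eq_one_comm.mp hM
  refine ⟨Matrix.vecMul (f ∘ e) M.conjTranspose, fun x => ?_⟩
  have hv : Matrix.vecMul (Matrix.vecMul (f ∘ e) M.conjTranspose) M = f ∘ e := by
    rw [Matrix.vecMul_vecMul, hM', Matrix.vecMul_one]
  have hx := congrFun hv (e.symm x)
  simpa [Matrix.vecMul, dotProduct, M] using hx.symm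

theorem isGaborONB_gaborWindow (p n : ℕ) [NeZero p] (C : ℝ)
    (hC : C ^ 2 * (p : ℝ) ^ (n + 2) = 1) :
    IsGaborONB (gaborWindow p n C)
      (Finset.univ.image fun s : ZMod p => (Fin.cons s 0 : Fin (n + 1) → ZMod p))
      (Finset.univ.image fun b : Fin n → ZMod p => (Fin.cons 0 b : Fin (n + 1) → ZMod p)) := by
  refine ⟨?_, fun f => ?_⟩
  · simp only [Finset.mem_image, Finset.mem_univ, true_and, forall_exists_index,
      forall_apply_eq_imp_iff]
    intro s b t c
    rw [innerC_gabor_gaborWindow p n C hC]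
    simp only [Fin.cons_inj, and_true, true_and]
  · obtain ⟨c, hc⟩ := exists_eq_sum_of_innerC_eq_ite (Fin.consEquiv fun _ : Fin (n + 1) => ZMod p)
      (fun i => gabor (gaborWindow p n C) (Fin.cons i.1 0) (Fin.cons 0 i.2))
      (fun i j => by rw [innerC_gabor_gaborWindow p n C hC]; simp only [Prod.ext_iff]) f
    refine ⟨fun a b => c (a 0, Fin.tail b), funext fun x => ?_⟩
    rw [hc x, Fintype.sum_prod_type, Finset.sum_image fun s _ t _ hst => (Fin.cons_inj.mp hst).1]
    refine Finset.sum_congr rfl fun s _ => ?_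
    rw [Finset.sum_image fun s _ t _ hst => (Fin.cons_inj.mp hst).2]
    simp

theorem ft_gaborWindow_zero (p n : ℕ) [NeZero p] (C : ℝ) :
    ft (gaborWindow p n C) 0 = ((p : ℂ) ^ (n + 1))⁻¹ * (C * (p * (p ^ n - 2))) := by
  rw [ft, sum_fin_cons]
  simp_rw [gaborWindow_cons, chi_eq_stdAddChar]
  simp only [dotp, Pi.zero_apply, mul_zero, Finset.sum_const_zero, neg_zero, AddChar.map_zero_eq_one,
    one_mul]
  simp_rw [← Finset.mul_sum, Finset.sum_sub_distrib]
  simp only [Finset.sum_ite_eq', Finset.mem_univ, if_true, Finset.sum_const, Finset.card_univ,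
    ZMod.card, nsmul_eq_mul, ← Finset.mul_sum, Fintype.card_pi, Finset.prod_const, Fintype.card_fin]
  push_cast
  ring

theorem ft_gaborWindow_cons_one (p n : ℕ) [Fact p.Prime] (C : ℝ) :
    ft (gaborWindow p n C) (Fin.cons 1 0) = ((p : ℂ) ^ (n + 1))⁻¹ * (C * (p * p ^ n)) := by
  have hfib : ∀ y : Fin n → ZMod p, ∑ u : ZMod p, (ZMod.stdAddChar (-u) : ℂ) *
      (C * ((if u = 0 then (p : ℂ) else 0) - if y = 0 then 2 else 0)) = C * p := by
    intro y
    have hsum : ∑ u : ZMod p, (ZMod.stdAddChar (-u) : ℂ) = 0 := by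
      simpa using sum_stdAddChar_mul p (-1)
    simp_rw [mul_left_comm _ (C : ℂ), mul_sub, Finset.sum_sub_distrib, ← Finset.mul_sum,
      ← Finset.sum_mul, hsum]
    simp
  rw [ft, sum_fin_cons]
  simp_rw [gaborWindow_cons, chi_eq_stdAddChar, dotp_cons]
  simp only [dotp, Pi.zero_apply, mul_zero, Finset.sum_const_zero, add_zero, mul_one, hfib]
  simp only [Finset.sum_const, Finset.card_univ, Fintype.card_pi, ZMod.card, Finset.prod_const,
    Fintype.card_fin, nsmul_eq_mul]
  push_cast
  ring

/-- A function with two distinct nonzero values is not a multiple of an indicator function. -/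
theorem not_exists_eq_indicator {V : Type*} [DecidableEq V] (h : V → ℝ) {x y : V} (hx : h x ≠ 0)
    (hy : h y ≠ 0) (hxy : h x ≠ h y) :
    ¬ ∃ (c : ℝ) (F : Finset V), 0 < c ∧ ∀ z, h z = if z ∈ F then c else 0 := by
  rintro ⟨c, F, -, hF⟩
  have hmem : ∀ z, h z ≠ 0 → h z = c := fun z hz => by
    rw [hF z] at hz ⊢
    exact if_pos (by by_contra hn; exact hz (if_neg hn))
  exact hxy ((hmem x hx).trans (hmem y hy).symm)

/-- For an odd prime `p` and `d ≥ 2` there is a Gabor orthonormal basis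
`𝒢(g, A, B)` of `L²(ℤ_p^d)` such that neither `|g|` nor `|ĝ|` is a positive constant
multiple of the indicator function of a set. -/
theorem exists_gabor_onb_window_not_indicator
    (p : ℕ) [Fact p.Prime] (hp : Odd p) (d : ℕ) (hd : 2 ≤ d) :
    ∃ (g : (Fin d → ZMod p) → ℂ) (A B : Finset (Fin d → ZMod p)),
      (∑ x, ‖g x‖ ^ 2 = 1) ∧ IsGaborONB g A B ∧
      (¬ ∃ (c : ℝ) (F : Finset (Fin d → ZMod p)), 0 < c ∧
        ∀ x, ‖g x‖ = if x ∈ F then c else 0) ∧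
      (¬ ∃ (c : ℝ) (F : Finset (Fin d → ZMod p)), 0 < c ∧
        ∀ m, ‖ft g m‖ = if m ∈ F then c else 0) := by
  obtain ⟨n, rfl⟩ : ∃ n, d = n + 1 := ⟨d - 1, by omega⟩
  have hn : n ≠ 0 := by omega
  have hp3 : (3 : ℝ) ≤ p := by
    have h2 := (Fact.out : p.Prime).two_le
    have : 3 ≤ p := by
      rcases hp with ⟨k, rfl⟩
      omega
    exact_mod_cast this
  have hpn : (3 : ℝ) ≤ (p : ℝ) ^ n := hp3.trans (le_self_pow₀ (by linarith) hn)
  have hpos : (0 : ℝ) < (p : ℝ) ^ (n + 2) := by positivity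
  obtain ⟨C, hC0, hC⟩ : ∃ C : ℝ, 0 < C ∧ C ^ 2 * (p : ℝ) ^ (n + 2) = 1 :=
    ⟨√((p : ℝ) ^ (n + 2))⁻¹, by positivity, by
      rw [Real.sq_sqrt (by positivity), inv_mul_cancel₀ hpos.ne']⟩
  have hnorm : ∀ (D e : ℝ), 0 < D → 0 < e → ‖((D * e : ℝ) : ℂ)‖ = D * e := fun D e hD he => by
    rw [Complex.norm_real, Real.norm_of_nonneg (by positivity)]
  refine ⟨gaborWindow p n C, _, _, ?_, isGaborONB_gaborWindow p n C hC, ?_, ?_⟩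
  · have h := innerC_gabor_gaborWindow p n C hC 0 0 0 0
    have h0 : (Fin.cons 0 0 : Fin (n + 1) → ZMod p) = 0 := by
      ext i
      refine Fin.cases ?_ (fun j => ?_) i <;> simp
    simp only [h0, and_self, if_true] at h
    have hg : gabor (gaborWindow p n C) 0 0 = gaborWindow p n C := by
      ext x
      simp [gabor, dotp, chi]
    rw [hg, innerC] at h
    simp_rw [Complex.mul_conj'] at h
    exact_mod_cast h
  · have e0 : ‖gaborWindow p n C (Fin.cons 0 0)‖ = C * (p - 2) := by
      rw [← hnorm C (p - 2) hC0 (by linarith), gaborWindow_cons]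
      simp
    have e1 : ‖gaborWindow p n C (Fin.cons 0 1)‖ = C * p := by
      have : NeZero n := ⟨hn⟩
      rw [← hnorm C p hC0 (by linarith), gaborWindow_cons]
      simp
    refine not_exists_eq_indicator (fun x => ‖gaborWindow p n C x‖) (x := Fin.cons 0 0)
      (y := Fin.cons 0 1) ?_ ?_ ?_ <;> simp only [e0, e1]
    · exact (mul_pos hC0 (by linarith)).ne'
    · exact (mul_pos hC0 (by linarith)).ne'
    · intro h
      linarith [mul_left_cancel₀ hC0.ne' h]
  · have hD : 0 < ((p : ℝ) ^ (n + 1))⁻¹ * C * p := by positivity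
    set D := ((p : ℝ) ^ (n + 1))⁻¹ * C * p with hDdef
    have e0 : ‖ft (gaborWindow p n C) 0‖ = D * (p ^ n - 2) := by
      rw [← hnorm D (p ^ n - 2) hD (by linarith), ft_gaborWindow_zero, hDdef]
      congr 1
      push_cast
      ring
    have e1 : ‖ft (gaborWindow p n C) (Fin.cons 1 0)‖ = D * p ^ n := by
      rw [← hnorm D (p ^ n) hD (by linarith), ft_gaborWindow_cons_one, hDdef]
      congr 1
      push_cast
      ring
    refine not_exists_eq_indicator (fun x => ‖ft (gaborWindow p n C) x‖) (x := 0)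
      (y := Fin.cons 1 0) ?_ ?_ ?_ <;> simp only [e0, e1]
    · exact (mul_pos hD (by linarith)).ne'
    · exact (mul_pos hD (by linarith)).ne'
    · intro h
      linarith [mul_left_cancel₀ hD.ne' h]
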